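/- Let p be a prime and let G = Z_p ⋊_φ H where H is abelian and φ satisfies property (⋆). Let D ⊆ G be a dissociated set with π_2(d) ∈ H_1 for every d ∈ D and with |D| divisible by 8, and let D = D^o ∪ D^e be a partition with |D^o| = |D^e| = |D|/2. Consider ordered partitions D^o = D^{o,(1)} ∪ D^{o,(2)} ∪ D^{o,(3)} ∪ D^{o,(4)} and D^e = D^{e,(1)} ∪ D^{e,(2)} ∪ D^{e,(3)} ∪ D^{e,(4)} into four parts of size |D|/8 each. Then for every nonempty proper interval I ⊊ {1,2,3,4} and every x ∈ G, the proportion of such pairs of ordered partitions for which the alternating product of ∪_{i∈I} D^{o,(i)} and ∪_{i∈I} D^{e,(i)} (elements of ∪_{i∈I} D^{o,(i)} in odd positions, elements of ∪_{i∈I} D^{e,(i)} in even positions; this product is independent of the orderings chosen within those two sets) equals x is at most 1/binom(|D|/2, |I|·|D|/8)^2. -/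

import Mathlib

open scoped Classical

/-- The partial products `p_i = l_1 ⋯ l_i` for `1 ≤ i ≤ n` are pairwise distinct
(valid ordering) and moreover `p_i ≠ 1` for `1 ≤ i ≤ n-1`. -/
def IsSequencing {G : Type*} [Group G] (l : List G) : Prop :=
  (∀ i ∈ Finset.Icc 1 l.length, ∀ j ∈ Finset.Icc 1 l.length,
    (l.take i).prod = (l.take j).prod → i = j) ∧
  ∀ i ∈ Finset.Ico 1 l.length, (l.take i).prod ≠ 1

/-- `l` is a sequencing of the finite set `A`. -/
def IsSequencingOf {G : Type*} [Group G] (l : List G) (A : Finset G) : Prop :=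
  l.Nodup ∧ l.toFinset = A ∧ IsSequencing l

/-- Every finite subset of `G \ {1}` is sequenceable. -/
def StronglySequenceable (G : Type*) [Group G] : Prop :=
  ∀ A : Finset G, (1 : G) ∉ A → ∃ l : List G, IsSequencingOf l A

/-- Property (⋆): every `φ h` is the identity or the negation automorphism of `ℤ/p`. -/
def PropertyStar {p : ℕ} {H : Type*} [Group H]
    (φ : H →* MulAut (Multiplicative (ZMod p))) : Prop :=
  ∀ h : H, φ h = 1 ∨ φ h = MulEquiv.inv (Multiplicative (ZMod p))

/-- `D` is dissociated: no nonempty product of distinct elements of `D`, each raised to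
the power `1` or `-1`, in any order, equals the identity.  (This is equivalent to the
formulation with a permutation of all of `D` and exponents in `{-1,0,1}`, not all `0`:
simply drop the factors with exponent `0`.) -/
def IsDissociated {G : Type*} [Group G] (D : Set G) : Prop :=
  ∀ l : List (G × ℤ), l ≠ [] → (l.map Prod.fst).Nodup →
    (∀ x ∈ l, x.1 ∈ D ∧ (x.2 = 1 ∨ x.2 = -1)) →
    (l.map fun x => x.1 ^ x.2).prod ≠ 1

/-- `interleave l₁ l₂` alternates the two lists, starting with `l₁`: the elements of
`l₁` occupy the odd positions and the elements of `l₂` the even positions. -/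
def interleave {α : Type*} : List α → List α → List α
  | [], l => l
  | a :: l, l' => a :: interleave l' l
termination_by l₁ l₂ => l₁.length + l₂.length
decreasing_by simp; omega

theorem interleave_cons_cons {α : Type*} (a b : α) (l₁ l₂ : List α) :
    interleave (a :: l₁) (b :: l₂) = a :: b :: interleave l₁ l₂ := by
  rw [interleave, interleave]

theorem map_interleave {α β : Type*} (f : α → β) (l₁ l₂ : List α) :
    (interleave l₁ l₂).map f = interleave (l₁.map f) (l₂.map f) := by
  fun_induction interleave l₁ l₂ with
  | case1 l => simp [interleave]
  | case2 l' a l ih => simp [interleave, ih]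

theorem interleave_perm {α : Type*} (l₁ l₂ : List α) : (interleave l₁ l₂).Perm (l₁ ++ l₂) := by
  fun_induction interleave l₁ l₂ with
  | case1 l => simp
  | case2 l' a l ih => exact (ih.trans List.perm_append_comm).cons _

section AlternatingProduct

variable {p : ℕ} {H : Type*} [CommGroup H] {φ : H →* MulAut (Multiplicative (ZMod p))}

theorem prod_interleave {l₁ l₂ : List (Multiplicative (ZMod p) ⋊[φ] H)}
    (hl : l₁.length = l₂.length)
    (h₁ : ∀ g ∈ l₁, φ g.right = MulEquiv.inv (Multiplicative (ZMod p)))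
    (h₂ : ∀ g ∈ l₂, φ g.right = MulEquiv.inv (Multiplicative (ZMod p))) :
    (interleave l₁ l₂).prod =
      ⟨(l₁.map (·.left)).prod / (l₂.map (·.left)).prod,
        (l₁.map (·.right)).prod * (l₂.map (·.right)).prod⟩ := by
  induction l₁ generalizing l₂ with
  | nil =>
    obtain rfl : l₂ = [] := List.length_eq_zero_iff.1 hl.symm
    ext <;> simp [interleave]
  | cons a l₁ ih =>
    obtain _ | ⟨b, l₂⟩ := l₂
    · simp at hl
    · simp only [List.mem_cons, forall_eq_or_imp, List.length_cons, Nat.add_right_cancel_iff]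
        at hl h₁ h₂
      rw [interleave_cons_cons, List.prod_cons, List.prod_cons, ih hl h₁.2 h₂.2]
      ext1
      · simp only [SemidirectProduct.mul_left, h₁.1, h₂.1, MulEquiv.inv_apply,
          List.map_cons, List.prod_cons, mul_inv, inv_inv, div_eq_mul_inv]
        simp only [mul_assoc, mul_left_comm]
      · simp only [SemidirectProduct.mul_right, List.map_cons, List.prod_cons]
        simp only [mul_assoc, mul_left_comm]

theorem left_inv_of_map_right_eq_inv {g : Multiplicative (ZMod p) ⋊[φ] H}
    (hg : φ g.right = MulEquiv.inv (Multiplicative (ZMod p))) : g⁻¹.left = g.left := by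
  rw [SemidirectProduct.inv_left, map_inv φ, hg]
  exact inv_inv g.left

theorem map_right_inv_eq_inv {g : Multiplicative (ZMod p) ⋊[φ] H}
    (hg : φ g.right = MulEquiv.inv (Multiplicative (ZMod p))) :
    φ g⁻¹.right = MulEquiv.inv (Multiplicative (ZMod p)) := by
  rw [SemidirectProduct.inv_right, map_inv, hg]
  rfl

/-- In a dissociated set, the signed alternating product with `X` and the inverses of
`Y'` in odd positions, and `Y` and the inverses of `X'` in even positions, is trivial only if all
the sets are empty. -/
theorem eq_empty_of_signed_alternating_prod_eq_one {D : Set (Multiplicative (ZMod p) ⋊[φ] H)}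
    (hD : IsDissociated D)
    (hmem : ∀ d ∈ D, φ d.right = MulEquiv.inv (Multiplicative (ZMod p)))
    {X X' Y Y' : Finset (Multiplicative (ZMod p) ⋊[φ] H)}
    (hX : ∀ g ∈ X, g ∈ D) (hX' : ∀ g ∈ X', g ∈ D) (hY : ∀ g ∈ Y, g ∈ D) (hY' : ∀ g ∈ Y', g ∈ D)
    (hXX' : Disjoint X X') (hYY' : Disjoint Y Y') (hXY : Disjoint (X ∪ X') (Y ∪ Y'))
    (hcX : X.card = X'.card) (hcY : Y.card = Y'.card)
    (hleft : (∏ g ∈ X, g.left) / ∏ g ∈ X', g.left = (∏ g ∈ Y, g.left) / ∏ g ∈ Y', g.left)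
    (hright : ((∏ g ∈ X, g.right) / ∏ g ∈ X', g.right) *
      ((∏ g ∈ Y, g.right) / ∏ g ∈ Y', g.right) = 1) :
    X = ∅ ∧ Y = ∅ := by
  set L₁ : List ((Multiplicative (ZMod p) ⋊[φ] H) × ℤ) :=
    X.toList.map (·, 1) ++ Y'.toList.map (·, -1) with hL₁
  set L₂ : List ((Multiplicative (ZMod p) ⋊[φ] H) × ℤ) :=
    X'.toList.map (·, -1) ++ Y.toList.map (·, 1) with hL₂
  by_contra hne
  have hperm := interleave_perm L₁ L₂
  refine hD (interleave L₁ L₂) ?_ ?_ ?_ ?_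
  · intro h0
    rw [h0] at hperm
    have := hperm.nil_eq
    apply hne
    simpa [hL₁, hL₂] using And.intro (show X = ∅ by simp_all) (show Y = ∅ by simp_all)
  · rw [(hperm.map Prod.fst).nodup_iff]
    simp only [hL₁, hL₂, List.map_append, List.map_map, Function.comp_def, List.map_id']
    simp only [List.nodup_append, Finset.nodup_toList, List.mem_append, Finset.mem_toList]
    simp only [Finset.disjoint_left, Finset.mem_union] at hXX' hYY' hXY
    refine ⟨⟨trivial, trivial, ?_⟩, ⟨trivial, trivial, ?_⟩, ?_⟩ <;> grind
  · intro y hy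
    rw [hperm.mem_iff] at hy
    simp only [hL₁, hL₂, List.mem_append, List.mem_map, Finset.mem_toList] at hy
    rcases hy with (⟨g, hg, rfl⟩ | ⟨g, hg, rfl⟩) | (⟨g, hg, rfl⟩ | ⟨g, hg, rfl⟩)
    · exact ⟨hX g hg, .inl rfl⟩
    · exact ⟨hY' g hg, .inr rfl⟩
    · exact ⟨hX' g hg, .inr rfl⟩
    · exact ⟨hY g hg, .inl rfl⟩
  · have e₁ : L₁.map (fun y => y.1 ^ y.2) = X.toList ++ Y'.toList.map (·⁻¹) := by
      simp [hL₁, Function.comp_def]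
    have e₂ : L₂.map (fun y => y.1 ^ y.2) = X'.toList.map (·⁻¹) ++ Y.toList := by
      simp [hL₂, Function.comp_def]
    have invleft : ∀ S : Finset (Multiplicative (ZMod p) ⋊[φ] H), (∀ g ∈ S, g ∈ D) →
        (S.toList.map (fun g => g⁻¹.left)).prod = ∏ g ∈ S, g.left := by
      intro S hS
      rw [Finset.prod_map_toList]
      exact Finset.prod_congr rfl fun g hg => left_inv_of_map_right_eq_inv (hmem g (hS g hg))
    have invright : ∀ S : Finset (Multiplicative (ZMod p) ⋊[φ] H),
        (S.toList.map (fun g => g⁻¹.right)).prod = (∏ g ∈ S, g.right)⁻¹ := by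
      intro S
      rw [Finset.prod_map_toList, ← Finset.prod_inv_distrib]
      rfl
    rw [map_interleave, e₁, e₂, prod_interleave]
    · simp only [List.map_append, List.map_map, Function.comp_def, List.prod_append,
        invleft _ hX', invleft _ hY', invright, Finset.prod_map_toList]
      ext1
      · rw [SemidirectProduct.one_left, div_eq_one, mul_comm (∏ g ∈ X', g.left)]
        exact div_eq_div_iff_mul_eq_mul.1 hleft
      · rw [SemidirectProduct.one_right, ← hright]
        simp only [div_eq_mul_inv, mul_assoc, mul_left_comm, mul_comm]
    · simp [hcX, hcY]
    · intro g hg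
      simp only [List.mem_append, List.mem_map, Finset.mem_toList] at hg
      rcases hg with hg | ⟨g, hg, rfl⟩
      · exact hmem g (hX g hg)
      · exact map_right_inv_eq_inv (hmem g (hY' g hg))
    · intro g hg
      simp only [List.mem_append, List.mem_map, Finset.mem_toList] at hg
      rcases hg with ⟨g, hg, rfl⟩ | hg
      · exact map_right_inv_eq_inv (hmem g (hX' g hg))
      · exact hmem g (hY g hg)

/-- The alternating product of two equinumerous subsets of disjoint pieces of a dissociated set
determines both subsets. -/
theorem toFinset_eq_of_prod_interleave_eq {D : Set (Multiplicative (ZMod p) ⋊[φ] H)}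
    (hD : IsDissociated D)
    (hmem : ∀ d ∈ D, φ d.right = MulEquiv.inv (Multiplicative (ZMod p)))
    {S T : Finset (Multiplicative (ZMod p) ⋊[φ] H)} (hST : Disjoint S T)
    (hS : ∀ g ∈ S, g ∈ D) (hT : ∀ g ∈ T, g ∈ D)
    {l₁ l₁' l₂ l₂' : List (Multiplicative (ZMod p) ⋊[φ] H)}
    (hn₁ : l₁.Nodup) (hn₁' : l₁'.Nodup) (hn₂ : l₂.Nodup) (hn₂' : l₂'.Nodup)
    (h₁ : ∀ g ∈ l₁, g ∈ S) (h₁' : ∀ g ∈ l₁', g ∈ S)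
    (h₂ : ∀ g ∈ l₂, g ∈ T) (h₂' : ∀ g ∈ l₂', g ∈ T)
    {k : ℕ} (hk₁ : l₁.length = k) (hk₁' : l₁'.length = k)
    (hk₂ : l₂.length = k) (hk₂' : l₂'.length = k)
    (hprod : (interleave l₁ l₂).prod = (interleave l₁' l₂').prod) :
    l₁.toFinset = l₁'.toFinset ∧ l₂.toFinset = l₂'.toFinset := by
  rw [prod_interleave (hk₁.trans hk₂.symm) (fun g hg => hmem g (hS g (h₁ g hg)))
      (fun g hg => hmem g (hT g (h₂ g hg))),
    prod_interleave (hk₁'.trans hk₂'.symm) (fun g hg => hmem g (hS g (h₁' g hg)))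
      (fun g hg => hmem g (hT g (h₂' g hg)))] at hprod
  simp only [SemidirectProduct.ext_iff, ← List.prod_toFinset _ hn₁,
    ← List.prod_toFinset _ hn₂, ← List.prod_toFinset _ hn₁', ← List.prod_toFinset _ hn₂'] at hprod
  have hc₁ := (List.toFinset_card_of_nodup hn₁).trans hk₁
  have hc₁' := (List.toFinset_card_of_nodup hn₁').trans hk₁'
  have hc₂ := (List.toFinset_card_of_nodup hn₂).trans hk₂
  have hc₂' := (List.toFinset_card_of_nodup hn₂').trans hk₂'
  simp only [← List.mem_toFinset] at h₁ h₁' h₂ h₂'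
  generalize l₁.toFinset = A at *
  generalize l₁'.toFinset = A' at *
  generalize l₂.toFinset = B at *
  generalize l₂'.toFinset = B' at *
  have hcA : (A \ A').card = (A' \ A).card := Finset.card_sdiff_comm (hc₁.trans hc₁'.symm)
  have hcB : (B \ B').card = (B' \ B).card := Finset.card_sdiff_comm (hc₂.trans hc₂'.symm)
  have key := eq_empty_of_signed_alternating_prod_eq_one hD hmem
    (X := A \ A') (X' := A' \ A) (Y := B \ B') (Y' := B' \ B)
    (fun g hg => hS g (h₁ g (Finset.sdiff_subset hg)))
    (fun g hg => hS g (h₁' g (Finset.sdiff_subset hg)))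
    (fun g hg => hT g (h₂ g (Finset.sdiff_subset hg)))
    (fun g hg => hT g (h₂' g (Finset.sdiff_subset hg)))
    disjoint_sdiff_sdiff disjoint_sdiff_sdiff
    (hST.mono (Finset.union_subset (Finset.sdiff_subset.trans h₁) (Finset.sdiff_subset.trans h₁'))
      (Finset.union_subset (Finset.sdiff_subset.trans h₂) (Finset.sdiff_subset.trans h₂')))
    hcA hcB
    (by
      rw [Finset.prod_sdiff_div_prod_sdiff, Finset.prod_sdiff_div_prod_sdiff,
        div_eq_div_iff_mul_eq_mul, mul_comm (∏ g ∈ B, g.left)]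
      exact div_eq_div_iff_mul_eq_mul.1 hprod.1)
    (by
      rw [Finset.prod_sdiff_div_prod_sdiff, Finset.prod_sdiff_div_prod_sdiff,
        div_mul_div_comm, div_eq_one]
      exact hprod.2)
  exact ⟨Finset.eq_of_subset_of_card_le (Finset.sdiff_eq_empty_iff_subset.1 key.1)
      (hc₁'.trans hc₁.symm).le,
    Finset.eq_of_subset_of_card_le (Finset.sdiff_eq_empty_iff_subset.1 key.2)
      (hc₂'.trans hc₂.symm).le⟩

end AlternatingProduct

section Counting

variable {α ι : Type*} [Fintype α] [DecidableEq α] [Fintype ι] [DecidableEq ι]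

/-- The ordered partitions of `α` into parts indexed by `ι`, each of size `m`. -/
def equipartitions (α ι : Type*) [Fintype α] [DecidableEq α] [Fintype ι] [DecidableEq ι]
    (m : ℕ) : Finset (α → ι) :=
  Finset.univ.filter fun c => ∀ i, (Finset.univ.filter fun y => c y = i).card = m

theorem card_preimage_of_mem_equipartitions {m : ℕ} {c : α → ι} (hc : c ∈ equipartitions α ι m)
    (I : Finset ι) : (Finset.univ.filter fun y => c y ∈ I).card = I.card * m := by
  rw [equipartitions, Finset.mem_filter] at hc
  rw [Finset.card_eq_sum_card_fiberwise (f := c) (t := I) (fun y hy => by simpa using hy),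
    ← smul_eq_mul, ← Finset.sum_const]
  refine Finset.sum_congr rfl fun i hi => ?_
  rw [← hc.2 i, Finset.filter_filter]
  congr 1
  ext y
  simp only [Finset.mem_filter, Finset.mem_univ, true_and]
  exact ⟨And.right, fun h => ⟨h ▸ hi, h⟩⟩

theorem card_equipartitions_preimage_le {m : ℕ} (I : Finset ι) {S S' : Finset α}
    (hS : S.card = S'.card) :
    ((equipartitions α ι m).filter fun c => (Finset.univ.filter fun y => c y ∈ I) = S).card ≤
    ((equipartitions α ι m).filter fun c => (Finset.univ.filter fun y => c y ∈ I) = S').card := by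
  let e : {y // y ∈ S'} ≃ {y // y ∈ S} := Finset.equivOfCardEq hS.symm
  let σ : Equiv.Perm α := e.extendSubtype
  have hσ : ∀ y, σ y ∈ S ↔ y ∈ S' := fun y =>
    ⟨fun h => by_contra fun h' => e.extendSubtype_not_mem y h' h, fun h => e.extendSubtype_mem y h⟩
  refine Finset.card_le_card_of_injOn (fun c => c ∘ σ) ?_ ?_
  · intro c hc
    simp only [equipartitions, Finset.coe_filter, Finset.mem_filter, Finset.mem_univ, true_and,
      Set.mem_ofPred_eq, Function.comp_apply] at hc ⊢
    refine ⟨fun i => ?_, ?_⟩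
    · rw [← hc.1 i]
      exact Finset.card_bij (fun y _ => σ y) (by simp) (by simp)
        fun y hy => ⟨σ.symm y, by simpa using hy, by simp⟩
    · ext y
      rw [← hσ y, ← hc.2]
      simp
  · intro c _ c' _ h
    exact σ.surjective.injective_comp_right h

theorem card_equipartitions_preimage_mul_choose_le {m k : ℕ} (I : Finset ι)
    (hk : I.card * m = k) {S : Finset α} (hS : S.card = k) :
    ((equipartitions α ι m).filter fun c => (Finset.univ.filter fun y => c y ∈ I) = S).card *
      (Fintype.card α).choose k ≤ (equipartitions α ι m).card := by
  rw [Finset.card_eq_sum_card_fiberwise (s := equipartitions α ι m)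
      (f := fun c => Finset.univ.filter fun y => c y ∈ I)
      (t := Finset.powersetCard k Finset.univ), mul_comm, ← Finset.card_univ,
    ← Finset.card_powersetCard, ← smul_eq_mul]
  · refine Finset.card_nsmul_le_sum _ _ _ fun S' hS' => card_equipartitions_preimage_le I ?_
    rw [hS, (Finset.mem_powersetCard.1 hS').2]
  · intro c hc
    simpa [Finset.mem_powersetCard, hk] using card_preimage_of_mem_equipartitions hc I

end Counting

/-- among all pairs of ordered partitions of `D^o` and `D^e` into four
parts of size `|D|/8`, the proportion for which the alternating product of the
`I`-indexed unions equals a fixed `x` is at most `1 / binom(|D|/2, |I|·|D|/8)^2`. -/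
theorem statement14 (p : ℕ) (hp : p.Prime) (H : Type*) [CommGroup H]
    (φ : H →* MulAut (Multiplicative (ZMod p))) (hφ : PropertyStar φ)
    (Do De : Finset (Multiplicative (ZMod p) ⋊[φ] H)) (hdisj : Disjoint Do De)
    (hdiss : IsDissociated ((Do ∪ De : Finset (Multiplicative (ZMod p) ⋊[φ] H)) :
      Set (Multiplicative (ZMod p) ⋊[φ] H)))
    (hmem : ∀ d ∈ Do ∪ De,
      φ (SemidirectProduct.right d) = MulEquiv.inv (Multiplicative (ZMod p)))
    (h8 : 8 ∣ (Do ∪ De).card)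
    (hco : Do.card = (Do ∪ De).card / 2) (hce : De.card = (Do ∪ De).card / 2)
    (I : Finset (Fin 4)) (hint : ∃ a b : Fin 4, I = Finset.Icc a b)
    (hne : I.Nonempty) (hproper : I ≠ Finset.univ)
    (x : Multiplicative (ZMod p) ⋊[φ] H) :
    (((Finset.univ.filter
        (fun pc : ({ y // y ∈ Do } → Fin 4) × ({ y // y ∈ De } → Fin 4) =>
          (∀ i : Fin 4,
            (Finset.univ.filter (fun y => pc.1 y = i)).card = (Do ∪ De).card / 8 ∧
            (Finset.univ.filter (fun y => pc.2 y = i)).card = (Do ∪ De).card / 8) ∧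
          ∃ lo le : List (Multiplicative (ZMod p) ⋊[φ] H), lo.Nodup ∧ le.Nodup ∧
            (∀ g, g ∈ lo ↔ ∃ h : g ∈ Do, pc.1 ⟨g, h⟩ ∈ I) ∧
            (∀ g, g ∈ le ↔ ∃ h : g ∈ De, pc.2 ⟨g, h⟩ ∈ I) ∧
            (interleave lo le).prod = x)).card : ℝ) /
      ((Finset.univ.filter
        (fun pc : ({ y // y ∈ Do } → Fin 4) × ({ y // y ∈ De } → Fin 4) =>
          ∀ i : Fin 4,
            (Finset.univ.filter (fun y => pc.1 y = i)).card = (Do ∪ De).card / 8 ∧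
            (Finset.univ.filter (fun y => pc.2 y = i)).card = (Do ∪ De).card / 8)).card : ℝ))
      ≤ 1 / ((Nat.choose ((Do ∪ De).card / 2) (I.card * ((Do ∪ De).card / 8)) : ℝ)) ^ 2 := by
  set n := (Do ∪ De).card with hn
  set m := n / 8 with hm
  set k := I.card * m with hk
  set F := Finset.univ.filter
        (fun pc : ({ y // y ∈ Do } → Fin 4) × ({ y // y ∈ De } → Fin 4) =>
          (∀ i : Fin 4,
            (Finset.univ.filter (fun y => pc.1 y = i)).card = m ∧
            (Finset.univ.filter (fun y => pc.2 y = i)).card = m) ∧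
          ∃ lo le : List (Multiplicative (ZMod p) ⋊[φ] H), lo.Nodup ∧ le.Nodup ∧
            (∀ g, g ∈ lo ↔ ∃ h : g ∈ Do, pc.1 ⟨g, h⟩ ∈ I) ∧
            (∀ g, g ∈ le ↔ ∃ h : g ∈ De, pc.2 ⟨g, h⟩ ∈ I) ∧
            (interleave lo le).prod = x) with hF
  have htotal : Finset.univ.filter
        (fun pc : ({ y // y ∈ Do } → Fin 4) × ({ y // y ∈ De } → Fin 4) =>
          ∀ i : Fin 4,
            (Finset.univ.filter (fun y => pc.1 y = i)).card = m ∧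
            (Finset.univ.filter (fun y => pc.2 y = i)).card = m) =
      equipartitions { y // y ∈ Do } (Fin 4) m ×ˢ equipartitions { y // y ∈ De } (Fin 4) m := by
    ext pc
    simp only [equipartitions, Finset.mem_product, Finset.mem_filter, Finset.mem_univ, true_and,
      forall_and]
  rw [htotal]
  have hFbal : ∀ pc ∈ F, pc.1 ∈ equipartitions { y // y ∈ Do } (Fin 4) m ∧
      pc.2 ∈ equipartitions { y // y ∈ De } (Fin 4) m := by
    intro pc hpc
    rw [← Finset.mem_product, ← htotal]
    simp only [hF, Finset.mem_filter, Finset.mem_univ, true_and] at hpc ⊢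
    exact hpc.1
  have htoFinset : ∀ (E : Finset (Multiplicative (ZMod p) ⋊[φ] H)) (c : { y // y ∈ E } → Fin 4)
      (l : List (Multiplicative (ZMod p) ⋊[φ] H)),
      (∀ g, g ∈ l ↔ ∃ h : g ∈ E, c ⟨g, h⟩ ∈ I) →
      l.toFinset = (Finset.univ.filter fun y => c y ∈ I).map (Function.Embedding.subtype _) := by
    intro E c l hl
    ext g
    simp [hl]
  have hlength : ∀ (E : Finset (Multiplicative (ZMod p) ⋊[φ] H)) (c : { y // y ∈ E } → Fin 4)
      (l : List (Multiplicative (ZMod p) ⋊[φ] H)),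
      c ∈ equipartitions { y // y ∈ E } (Fin 4) m → l.Nodup →
      (∀ g, g ∈ l ↔ ∃ h : g ∈ E, c ⟨g, h⟩ ∈ I) → l.length = k := by
    intro E c l hc hnd hl
    rw [← List.toFinset_card_of_nodup hnd, htoFinset E c l hl, Finset.card_map,
      card_preimage_of_mem_equipartitions hc]
  have hunique : ∀ pc ∈ F, ∀ pc' ∈ F,
      (Finset.univ.filter fun y => pc'.1 y ∈ I) = (Finset.univ.filter fun y => pc.1 y ∈ I) ∧
      (Finset.univ.filter fun y => pc'.2 y ∈ I) = (Finset.univ.filter fun y => pc.2 y ∈ I) := by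
    intro pc hpc pc' hpc'
    obtain ⟨hb₁, hb₂⟩ := hFbal pc hpc
    obtain ⟨hb₁', hb₂'⟩ := hFbal pc' hpc'
    simp only [hF, Finset.mem_filter, Finset.mem_univ, true_and] at hpc hpc'
    obtain ⟨-, lo, le, hlo, hle, hmlo, hmle, hx⟩ := hpc
    obtain ⟨-, lo', le', hlo', hle', hmlo', hmle', hx'⟩ := hpc'
    have := toFinset_eq_of_prod_interleave_eq hdiss
      (fun d hd => hmem d hd) hdisj
      (fun g hg => Finset.mem_union_left _ hg) (fun g hg => Finset.mem_union_right _ hg)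
      hlo' hlo hle' hle
      (fun g hg => ((hmlo' g).1 hg).1) (fun g hg => ((hmlo g).1 hg).1)
      (fun g hg => ((hmle' g).1 hg).1) (fun g hg => ((hmle g).1 hg).1)
      (hlength _ _ _ hb₁' hlo' hmlo') (hlength _ _ _ hb₁ hlo hmlo)
      (hlength _ _ _ hb₂' hle' hmle') (hlength _ _ _ hb₂ hle hmle) (hx'.trans hx.symm)
    rwa [htoFinset _ _ _ hmlo, htoFinset _ _ _ hmlo', htoFinset _ _ _ hmle,
      htoFinset _ _ _ hmle', Finset.map_inj, Finset.map_inj] at this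
  have hmain : F.card * ((n / 2).choose k) ^ 2 ≤
      (equipartitions { y // y ∈ Do } (Fin 4) m ×ˢ
        equipartitions { y // y ∈ De } (Fin 4) m).card := by
    obtain hF0 | ⟨pc, hpc⟩ := F.eq_empty_or_nonempty
    · simp [hF0]
    obtain ⟨hb₁, hb₂⟩ := hFbal pc hpc
    have b₁ := card_equipartitions_preimage_mul_choose_le I hk.symm
      (card_preimage_of_mem_equipartitions hb₁ I)
    have b₂ := card_equipartitions_preimage_mul_choose_le I hk.symm
      (card_preimage_of_mem_equipartitions hb₂ I)
    rw [Fintype.card_coe, hco] at b₁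
    rw [Fintype.card_coe, hce] at b₂
    rw [Finset.card_product]
    refine le_trans ?_ (Nat.mul_le_mul b₁ b₂)
    rw [mul_mul_mul_comm, ← sq, ← Finset.card_product]
    refine Nat.mul_le_mul_right _ (Finset.card_le_card fun pc' hpc' => ?_)
    simp only [Finset.mem_product, Finset.mem_filter]
    exact ⟨⟨(hFbal pc' hpc').1, (hunique pc hpc pc' hpc').1⟩,
      ⟨(hFbal pc' hpc').2, (hunique pc hpc pc' hpc').2⟩⟩
  have hkn : k ≤ n / 2 := by
    have : I.card ≤ 4 := by simpa using I.card_le_univ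
    have : I.card * m ≤ 4 * m := Nat.mul_le_mul_right _ this
    omega
  have hchoose : (0 : ℝ) < ((n / 2).choose k : ℝ) ^ 2 := by
    have := Nat.choose_pos hkn
    positivity
  rw [le_div_iff₀ hchoose, div_mul_eq_mul_div]
  exact div_le_one_of_le₀ (by exact_mod_cast hmain) (Nat.cast_nonneg _)
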